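/- Let λ = (λ_1 ≥ … ≥ λ_ℓ > 0) be a partition of n and let m ≥ 1. Let θ_{α,k} ∈ ℕ (1 ≤ α ≤ ℓ, 1 ≤ k ≤ m) satisfy Σ_{k=1}^{m} θ_{α,k} = λ_α for every α, and set λ^{(k)}_α := Σ_{j=1}^{k} θ_{α,j} and λ^{(k)}_{ℓ+1} := 0. Suppose the associated row-nondecreasing tableau is NOT semistandard, i.e. there exist k ∈ {1,…,m} and α ∈ {1,…,ℓ−1} with λ^{(k)}_{α+1} > λ^{(k−1)}_α. Then, in the field ℚ(q,t), ∏_{k=1}^{m} ∏_{1≤α≤β≤ℓ} [ (q^{λ^{(k−1)}_α − λ^{(k−1)}_β} t^{β−α+1}; q)_{θ_{α,k}} · (q^{λ^{(k−1)}_α − λ^{(k)}_{β+1} + 1} t^{β−α}; q)_{θ_{α,k}} ] / [ (q^{λ^{(k−1)}_α − λ^{(k−1)}_β + 1} t^{β−α}; q)_{θ_{α,k}} · (q^{λ^{(k−1)}_α − λ^{(k)}_{β+1}} t^{β−α+1}; q)_{θ_{α,k}} ] = 0. -/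

import Mathlib

noncomputable section

/-- The field ℚ(q,t) of rational functions in two independent indeterminates over ℚ. -/
abbrev K : Type := FractionRing (MvPolynomial (Fin 2) ℚ)

def q : K := algebraMap (MvPolynomial (Fin 2) ℚ) K (MvPolynomial.X 0)
def t : K := algebraMap (MvPolynomial (Fin 2) ℚ) K (MvPolynomial.X 1)

/-- The q-Pochhammer symbol `(u;q)_n = ∏_{i=0}^{n-1} (1 - qⁱ u)`. -/
def qPoch (q u : K) (n : ℕ) : K := ∏ i ∈ Finset.range n, (1 - q ^ i * u)

/-- The partial sums `λ^{(k)}_α = Σ_{j=1}^{k} θ_{α,j}`. -/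
def pl (θ : ℕ → ℕ → ℕ) (α k : ℕ) : ℕ := ∑ j ∈ Finset.Icc 1 k, θ α j

/-- The partial sums extended by `λ^{(k)}_α := 0` for `α > ℓ`. -/
def plE (l : ℕ) (θ : ℕ → ℕ → ℕ) (α k : ℕ) : ℕ := if α ≤ l then pl θ α k else 0

theorem q_ne_zero : q ≠ 0 := by
  rw [q, Ne, FaithfulSMul.algebraMap_eq_zero_iff]
  exact MvPolynomial.X_ne_zero 0

theorem pl_add_theta (θ : ℕ → ℕ → ℕ) (α : ℕ) {k : ℕ} (hk : 1 ≤ k) :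
    pl θ α (k - 1) + θ α k = pl θ α k := by
  obtain ⟨k, rfl⟩ := Nat.exists_eq_add_of_le' hk
  simp only [pl, Nat.add_sub_cancel]
  rw [Finset.sum_Icc_succ_top (by omega)]

/-- `(q^{-i};q)_n = 0` for `i < n`. -/
theorem qPoch_zpow_eq_zero {n i : ℕ} {a : ℤ} (hi : i < n) (ha : a = -(i : ℤ)) :
    qPoch q (q ^ a) n = 0 := by
  refine Finset.prod_eq_zero (Finset.mem_range.mpr hi) ?_
  rw [ha, zpow_neg, zpow_natCast, mul_inv_cancel₀ (pow_ne_zero _ q_ne_zero), sub_self]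

/-- If column-strictness fails between two rows at some step but the rows are ordered at step `m`,
then at the last failing step the rows are already ordered. -/
theorem exists_last_violation (θ : ℕ → ℕ → ℕ) (α m : ℕ)
    (hm : pl θ (α + 1) m ≤ pl θ α m)
    (h : ∃ k ∈ Finset.Icc 1 m, pl θ α (k - 1) < pl θ (α + 1) k) :
    ∃ k ∈ Finset.Icc 1 m, pl θ α (k - 1) < pl θ (α + 1) k ∧ pl θ (α + 1) k ≤ pl θ α k := by
  obtain ⟨k₀, hk₀, h₀⟩ := h
  obtain ⟨k, hk, hmax⟩ :=
    ((Finset.Icc 1 m).filter fun k => pl θ α (k - 1) < pl θ (α + 1) k).exists_max_image id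
      ⟨k₀, Finset.mem_filter.mpr ⟨hk₀, h₀⟩⟩
  obtain ⟨hkm, hlt⟩ := Finset.mem_filter.mp hk
  refine ⟨k, hkm, hlt, ?_⟩
  rw [Finset.mem_Icc] at hkm
  obtain rfl | hne := hkm.2.eq_or_lt
  · exact hm
  · by_contra! hgt
    have hstep : pl θ (α + 1) k ≤ pl θ (α + 1) (k + 1) := by
      have := pl_add_theta θ (α + 1) (k := k + 1) (by omega)
      rw [Nat.add_sub_cancel] at this
      omega
    have := hmax (k + 1) (Finset.mem_filter.mpr
      ⟨Finset.mem_Icc.mpr ⟨by omega, hne⟩, by rw [Nat.add_sub_cancel]; omega⟩)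
    simp at this

/-- if the row-nondecreasing tableau encoded by θ is not
semistandard, i.e. `λ^{(k)}_{α+1} > λ^{(k-1)}_α` for some `k ∈ {1,…,m}`,
`α ∈ {1,…,ℓ-1}`, then Macdonald's tableau coefficient `ψ_T(q,t)`, written in
finite q-Pochhammer form, vanishes in ℚ(q,t). -/
theorem stmt11 (n l m : ℕ) (lam : ℕ → ℕ) (θ : ℕ → ℕ → ℕ)
    (hl : 1 ≤ l) (hm : 1 ≤ m)
    (hpos : ∀ α ∈ Finset.Icc 1 l, 0 < lam α)
    (hanti : ∀ α β, 1 ≤ α → α ≤ β → β ≤ l → lam β ≤ lam α)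
    (hsum : ∑ α ∈ Finset.Icc 1 l, lam α = n)
    (hθ : ∀ α ∈ Finset.Icc 1 l, ∑ k ∈ Finset.Icc 1 m, θ α k = lam α)
    (hNSS : ∃ k ∈ Finset.Icc 1 m, ∃ α ∈ Finset.Icc 1 (l - 1),
      pl θ α (k - 1) < pl θ (α + 1) k) :
    ∏ k ∈ Finset.Icc 1 m, ∏ α ∈ Finset.Icc 1 l, ∏ β ∈ Finset.Icc α l,
        (qPoch q (q ^ ((pl θ α (k - 1) : ℤ) - (pl θ β (k - 1) : ℤ)) *
              t ^ ((β : ℤ) - α + 1)) (θ α k) *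
            qPoch q (q ^ ((pl θ α (k - 1) : ℤ) - (plE l θ (β + 1) k : ℤ) + 1) *
              t ^ ((β : ℤ) - α)) (θ α k)) /
          (qPoch q (q ^ ((pl θ α (k - 1) : ℤ) - (pl θ β (k - 1) : ℤ) + 1) *
              t ^ ((β : ℤ) - α)) (θ α k) *
            qPoch q (q ^ ((pl θ α (k - 1) : ℤ) - (plE l θ (β + 1) k : ℤ)) *
              t ^ ((β : ℤ) - α + 1)) (θ α k))
      = 0 := by
  obtain ⟨k₀, hk₀, α, hα, h₀⟩ := hNSS
  rw [Finset.mem_Icc] at hα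
  have hαl : α ∈ Finset.Icc 1 l := Finset.mem_Icc.mpr ⟨hα.1, by omega⟩
  have hαl' : α + 1 ∈ Finset.Icc 1 l := Finset.mem_Icc.mpr ⟨by omega, by omega⟩
  have hle : pl θ (α + 1) m ≤ pl θ α m := by
    rw [pl, pl, hθ _ hαl, hθ _ hαl']
    exact hanti _ _ hα.1 (by omega) (by omega)
  obtain ⟨k, hk, hlt, hord⟩ := exists_last_violation θ α m hle ⟨k₀, hk₀, h₀⟩
  have hstep := pl_add_theta θ α (Finset.mem_Icc.mp hk).1
  refine Finset.prod_eq_zero hk (Finset.prod_eq_zero hαl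
    (Finset.prod_eq_zero (Finset.mem_Icc.mpr ⟨le_rfl, by omega⟩ : α ∈ Finset.Icc α l) ?_))
  have hzero : qPoch q (q ^ ((pl θ α (k - 1) : ℤ) - (plE l θ (α + 1) k : ℤ) + 1) *
      t ^ ((α : ℤ) - α)) (θ α k) = 0 := by
    rw [sub_self, zpow_zero, mul_one, plE, if_pos (by omega)]
    exact qPoch_zpow_eq_zero (i := pl θ (α + 1) k - pl θ α (k - 1) - 1) (by omega) (by omega)
  rw [hzero, mul_zero, zero_div]

end
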